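/- arXiv:2205.04988 — 2 statements merged into one kernel-verified Lean document; each statement's English description precedes it below -/
import Mathlib

section
/- For natural numbers n and m with 1 ≤ m ≤ n, the identity P(n, m) = ∑_{k=0}^{n−m} ∑_{i=0}^{k} (−1)^i · P(k − i(i−1)/2, i) · P(n − k − m(i+1)) holds, where every term in which an argument of P(·, ·) or P(·) is negative is zero. -/
/-- `P n`, the number of integer partitions of `n`. -/
def partitionCount (n : ℕ) : ℕ := Fintype.card (Nat.Partition n)

/-- `P(n, m)`, the number of integer partitions of `n` into exactly `m` parts. -/
def partitionsInParts (n m : ℕ) : ℕ :=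
  Fintype.card {p : n.Partition // p.parts.card = m}

/-- The multisets of `m` positive integers with sum `n`. -/
def partsSet (n m : ℕ) : Set (Multiset ℕ) :=
  {s | (∀ i ∈ s, 0 < i) ∧ s.sum = n ∧ Multiset.card s = m}

/-- Partitions of `n` into `m` parts, as multisets. -/
def partitionEquivPartsSet (n m : ℕ) :
    {p : n.Partition // p.parts.card = m} ≃ partsSet n m where
  toFun p := ⟨p.1.parts, fun _ hi => p.1.parts_pos hi, p.1.parts_sum, p.2⟩
  invFun s := ⟨⟨s.1, fun {_} hi => s.2.1 _ hi, s.2.2.1⟩, s.2.2.2⟩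
  left_inv _ := rfl
  right_inv _ := rfl

theorem partitionsInParts_eq_ncard (n m : ℕ) :
    partitionsInParts n m = (partsSet n m).ncard := by
  rw [partitionsInParts, ← Nat.card_eq_fintype_card, ← Nat.card_coe_set_eq]
  exact Nat.card_congr (partitionEquivPartsSet n m)

theorem partsSet_finite (n m : ℕ) : (partsSet n m).Finite :=
  Finite.of_equiv _ (partitionEquivPartsSet n m)

theorem card_le_of_mem_partsSet {n m : ℕ} {s : Multiset ℕ} (hs : s ∈ partsSet n m) : m ≤ n := by
  obtain ⟨hpos, rfl, rfl⟩ := hs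
  simpa using Multiset.card_nsmul_le_sum (a := 1) fun i hi => hpos i hi

theorem partitionsInParts_eq_zero {n m : ℕ} (h : n < m) : partitionsInParts n m = 0 := by
  rw [partitionsInParts_eq_ncard, Set.eq_empty_of_forall_notMem (s := partsSet n m),
    Set.ncard_empty]
  exact fun s hs => (card_le_of_mem_partsSet hs).not_gt h

theorem partitionsInParts_zero_right (n : ℕ) :
    partitionsInParts n 0 = if n = 0 then 1 else 0 := by
  rw [partitionsInParts_eq_ncard]
  split_ifs with h
  · subst h
    convert Set.ncard_singleton (0 : Multiset ℕ)
    ext s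
    simp only [partsSet, Set.mem_ofPred_eq, Set.mem_singleton_iff, Multiset.card_eq_zero]
    exact ⟨fun h => h.2.2, by rintro rfl; simp⟩
  · convert Set.ncard_empty (Multiset ℕ)
    ext s
    simp only [partsSet, Set.mem_ofPred_eq, Set.mem_empty_iff_false, Multiset.card_eq_zero,
      iff_false]
    rintro ⟨-, hs, rfl⟩
    exact h (by simpa using hs.symm)

theorem sum_map_succ (s : Multiset ℕ) : (s.map Nat.succ).sum = s.sum + Multiset.card s := by
  induction s using Multiset.induction_on with
  | empty => simp
  | cons a s ih => simp [ih]; omega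

theorem map_succ_mem_partsSet {n m : ℕ} {s : Multiset ℕ} (hs : s ∈ partsSet n m) :
    s.map Nat.succ ∈ partsSet (n + m) m := by
  obtain ⟨-, rfl, rfl⟩ := hs
  exact ⟨by simp, sum_map_succ s, by simp⟩

theorem cons_one_mem_partsSet {n m : ℕ} {s : Multiset ℕ} (hs : s ∈ partsSet n m) :
    1 ::ₘ s ∈ partsSet (n + 1) (m + 1) := by
  obtain ⟨hpos, rfl, rfl⟩ := hs
  exact ⟨by simpa using hpos, by simp [add_comm], by simp⟩

theorem mem_partsSet_of_cons_one {n m : ℕ} {s : Multiset ℕ}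
    (hs : 1 ::ₘ s ∈ partsSet (n + 1) (m + 1)) : s ∈ partsSet n m := by
  obtain ⟨hpos, hsum, hcard⟩ := hs
  simp only [Multiset.sum_cons, Multiset.card_cons] at hsum hcard
  exact ⟨fun i hi => hpos i (Multiset.mem_cons_of_mem hi), by omega, by omega⟩

theorem exists_map_succ_of_one_notMem {n m : ℕ} {s : Multiset ℕ} (hs : s ∈ partsSet n m)
    (h1 : 1 ∉ s) : m ≤ n ∧ ∃ t ∈ partsSet (n - m) m, t.map Nat.succ = s := by
  obtain ⟨hpos, rfl, rfl⟩ := hs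
  have hmap : (s.map Nat.pred).map Nat.succ = s := by
    rw [Multiset.map_map]
    conv_rhs => rw [← Multiset.map_id s]
    exact Multiset.map_congr rfl fun i hi => Nat.succ_pred_eq_of_pos (hpos i hi)
  have hsum := sum_map_succ (s.map Nat.pred)
  rw [hmap, Multiset.card_map] at hsum
  refine ⟨by omega, s.map Nat.pred, ⟨?_, by omega, by simp⟩, hmap⟩
  intro i hi
  obtain ⟨j, hj, rfl⟩ := Multiset.mem_map.1 hi
  have := hpos j hj
  have : j ≠ 1 := fun h => h1 (h ▸ hj)
  simp only [Nat.pred_eq_sub_one]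
  omega

theorem partsSet_succ_succ (n m : ℕ) :
    partsSet (n + 1) (m + 1) = (1 ::ₘ ·) '' partsSet n m ∪
      (if m ≤ n then Multiset.map Nat.succ '' partsSet (n - m) (m + 1) else ∅) := by
  ext s
  constructor
  · intro hs
    by_cases h1 : 1 ∈ s
    · obtain ⟨t, rfl⟩ := Multiset.exists_cons_of_mem h1
      exact Or.inl ⟨t, mem_partsSet_of_cons_one hs, rfl⟩
    · obtain ⟨hle, t, ht, rfl⟩ := exists_map_succ_of_one_notMem hs h1
      rw [Nat.add_sub_add_right] at ht
      rw [if_pos (by omega)]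
      exact Or.inr ⟨t, ht, rfl⟩
  · rintro (⟨t, ht, rfl⟩ | hs)
    · exact cons_one_mem_partsSet ht
    · split_ifs at hs with h
      · obtain ⟨t, ht, rfl⟩ := hs
        have := map_succ_mem_partsSet ht
        rwa [show n - m + (m + 1) = n + 1 by omega] at this
      · exact hs.elim

theorem partitionsInParts_succ_succ (n m : ℕ) :
    partitionsInParts (n + 1) (m + 1) = partitionsInParts n m +
      if m ≤ n then partitionsInParts (n - m) (m + 1) else 0 := by
  simp only [partitionsInParts_eq_ncard]
  have hfin : (if m ≤ n then Multiset.map Nat.succ '' partsSet (n - m) (m + 1) else ∅).Finite := by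
    split_ifs
    · exact (partsSet_finite _ _).image _
    · exact Set.finite_empty
  rw [partsSet_succ_succ, Set.ncard_union_eq ?_ ((partsSet_finite n m).image _) hfin]
  · rw [Set.ncard_image_of_injective _ fun _ _ h => Multiset.cons_inj_right 1 |>.1 h]
    split_ifs with h
    · rw [Set.ncard_image_of_injective _ (Multiset.map_injective Nat.succ_injective)]
    · simp
  · rw [Set.disjoint_left]
    rintro _ ⟨t, -, rfl⟩ hs
    split_ifs at hs with h
    · obtain ⟨u, hu, hut⟩ := hs
      have h1 : 1 ∈ u.map Nat.succ := hut ▸ Multiset.mem_cons_self 1 t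
      obtain ⟨j, hj, hj1⟩ := Multiset.mem_map.1 h1
      have := hu.1 j hj
      omega
    · exact hs

theorem partitionCount_eq_sum {n N : ℕ} (h : n < N) :
    partitionCount n = ∑ m ∈ Finset.range N, partitionsInParts n m := by
  simp only [partitionCount, partitionsInParts, Fintype.card_subtype]
  rw [← Finset.card_univ]
  refine Finset.card_eq_sum_card_fiberwise fun p _ => ?_
  have := card_le_of_mem_partsSet
    ((partitionEquivPartsSet n (Multiset.card p.parts)) ⟨p, rfl⟩).2
  simp only [Finset.coe_range, Set.mem_Iio]
  omega

section Nilpotent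

variable {R : Type*} [CommRing R] {x : R} {K : ℕ} {F : ℕ → R}

/-- The truncation of Euler's series `∑ (-1)^i x^(m i + i (i - 1) / 2) F i` for
`∏ (1 - x^j)` over `j > m`, when `F i = x^i / ((1 - x) ⋯ (1 - x^i))`. -/
def eulerSum (x : R) (K : ℕ) (F : ℕ → R) (m : ℕ) : R :=
  ∑ i ∈ Finset.range K, (-1) ^ i * x ^ (m * i + i * (i - 1) / 2) * F i

theorem triangle_succ (i : ℕ) : (i + 1) * (i + 1 - 1) / 2 = i * (i - 1) / 2 + i := by
  simpa [Finset.sum_range_id] using Finset.sum_range_succ (fun j => j) i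

theorem eulerSum_eq_mul (hx : x ^ K = 0)
    (hF : ∀ m, F (m + 1) * (1 - x ^ (m + 1)) = x * F m) (m : ℕ) :
    eulerSum x K F m = (1 - x ^ (m + 1)) * eulerSum x K F (m + 1) := by
  have key : ∀ N, eulerSum x (N + 1) F m =
      eulerSum x (N + 1) F (m + 1) - x ^ (m + 1) * eulerSum x N F (m + 1) := by
    intro N
    induction N with
    | zero => simp [eulerSum]
    | succ N ih =>
      unfold eulerSum at ih ⊢
      rw [Finset.sum_range_succ, ih, Finset.sum_range_succ _ (N + 1),
        Finset.sum_range_succ _ N, triangle_succ]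
      linear_combination (-1) ^ (N + 1) * x ^ (m * (N + 1) + (N * (N - 1) / 2 + N)) * hF N
  cases K with
  | zero => simp [eulerSum]
  | succ N =>
    have hlast : x ^ (m + 1) * ((-1) ^ N * x ^ ((m + 1) * N + N * (N - 1) / 2) * F N) = 0 := by
      have : x ^ ((m + 1) * (N + 1)) = 0 := by rw [mul_comm, pow_mul, hx, zero_pow (by omega)]
      linear_combination (-1) ^ N * x ^ (N * (N - 1) / 2) * F N * this
    have hsplit : eulerSum x (N + 1) F (m + 1) = eulerSum x N F (m + 1) +
        (-1) ^ N * x ^ ((m + 1) * N + N * (N - 1) / 2) * F N := by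
      rw [eulerSum, Finset.sum_range_succ, eulerSum]
    rw [key]
    linear_combination x ^ (m + 1) * hsplit + hlast

theorem eulerSum_self (hx : x ^ K = 0) (hF0 : F 0 = 1) : eulerSum x K F K = 1 := by
  cases K with
  | zero => simpa [eulerSum] using hx.symm
  | succ N =>
    rw [eulerSum, Finset.sum_range_succ', Finset.sum_eq_zero]
    · simp [hF0]
    · intro i _
      rw [mul_add_one (N + 1), add_right_comm, pow_add _ _ (N + 1), hx]
      simp

theorem mul_eulerSum_zero (hx : x ^ K = 0) (hF0 : F 0 = 1)
    (hF : ∀ m, F (m + 1) * (1 - x ^ (m + 1)) = x * F m) (m : ℕ) :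
    F m * eulerSum x K F 0 = x ^ m * eulerSum x K F m := by
  induction m with
  | zero => simp [hF0]
  | succ m ih =>
    have hnil : IsNilpotent (x ^ (m + 1)) := (show IsNilpotent x from ⟨K, hx⟩).pow_succ m
    refine hnil.isUnit_one_sub.mul_right_cancel ?_
    linear_combination eulerSum x K F 0 * hF m + x * ih +
      x ^ (m + 1) * eulerSum_eq_mul hx hF m

theorem sum_pow_mul_eulerSum (hx : x ^ K = 0)
    (hF : ∀ m, F (m + 1) * (1 - x ^ (m + 1)) = x * F m) (M : ℕ) :
    ∑ m ∈ Finset.range (M + 1), x ^ m * eulerSum x K F m = eulerSum x K F M := by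
  induction M with
  | zero => simp
  | succ M ih =>
    rw [Finset.sum_range_succ, ih]
    linear_combination eulerSum_eq_mul hx hF M

theorem eq_pow_mul_eulerSum_mul_sum (hx : x ^ K = 0) (hF0 : F 0 = 1)
    (hF : ∀ m, F (m + 1) * (1 - x ^ (m + 1)) = x * F m) (m : ℕ) :
    F m = x ^ m * eulerSum x K F m * ∑ j ∈ Finset.range (K + 1), F j := by
  have h : (∑ j ∈ Finset.range (K + 1), F j) * eulerSum x K F 0 = 1 := by
    rw [Finset.sum_mul, Finset.sum_congr rfl fun j _ => mul_eulerSum_zero hx hF0 hF j,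
      sum_pow_mul_eulerSum hx hF, eulerSum_self hx hF0]
  rw [← mul_eulerSum_zero hx hF0 hF]
  linear_combination -F m * h

end Nilpotent

open PowerSeries in
/-- The generating function of partitions into exactly `m` parts. -/
noncomputable def partsSeries (m : ℕ) : ℤ⟦X⟧ :=
  PowerSeries.mk fun n => (partitionsInParts n m : ℤ)

open PowerSeries in
/-- The generating function of partitions. -/
noncomputable def partitionSeries : ℤ⟦X⟧ :=
  PowerSeries.mk fun n => (partitionCount n : ℤ)

open PowerSeries in
theorem partsSeries_zero : partsSeries 0 = 1 := by
  ext n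
  simp [partsSeries, partitionsInParts_zero_right, PowerSeries.coeff_one]

open PowerSeries in
theorem partsSeries_succ_mul (m : ℕ) :
    partsSeries (m + 1) * (1 - X ^ (m + 1)) = X * partsSeries m := by
  have h : partsSeries (m + 1) = X * partsSeries m + X ^ (m + 1) * partsSeries (m + 1) := by
    ext n
    cases n with
    | zero => simp [partsSeries, partitionsInParts_eq_zero]
    | succ n =>
      rw [map_add, coeff_succ_X_mul, coeff_X_pow_mul']
      simp [partsSeries, partitionsInParts_succ_succ n m]
  linear_combination h

open PowerSeries in
theorem X_pow_dvd_partitionSeries_sub (K : ℕ) :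
    X ^ K ∣ partitionSeries - ∑ m ∈ Finset.range (K + 1), partsSeries m := by
  rw [X_pow_dvd_iff]
  intro n hn
  simp [partitionSeries, partsSeries, partitionCount_eq_sum (show n < K + 1 by omega)]

open PowerSeries in
theorem X_pow_dvd_partsSeries_sub (K m : ℕ) :
    X ^ K ∣ partsSeries m - X ^ m * eulerSum X K partsSeries m * partitionSeries := by
  let φ := Ideal.Quotient.mk (Ideal.span {(X : ℤ⟦X⟧) ^ K})
  have hφ : ∀ a b, φ a = φ b ↔ X ^ K ∣ a - b := fun a b => by
    rw [Ideal.Quotient.eq, Ideal.mem_span_singleton]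
  have hx : φ X ^ K = 0 := by
    rw [← map_pow, ← map_zero φ, hφ, sub_zero]
  have h := eq_pow_mul_eulerSum_mul_sum (F := fun m => φ (partsSeries m)) hx
    (by simp [partsSeries_zero])
    (fun m => by simpa using congrArg φ (partsSeries_succ_mul m)) m
  rw [← hφ, map_mul, (hφ _ _).2 (X_pow_dvd_partitionSeries_sub K)]
  simpa [eulerSum] using h

open PowerSeries in
theorem partitionsInParts_eq_sum_coeff (n m : ℕ) :
    (partitionsInParts n m : ℤ) = ∑ i ∈ Finset.range (n + 1), (-1) ^ i *
      coeff n (X ^ (i * (i - 1) / 2) * partsSeries i *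
        (X ^ (m * (i + 1)) * partitionSeries)) := by
  have h := X_pow_dvd_iff.1 (X_pow_dvd_partsSeries_sub (n + 1) m) n n.lt_succ_self
  rw [map_sub, sub_eq_zero, partsSeries, coeff_mk] at h
  rw [h, eulerSum, Finset.mul_sum, Finset.sum_mul, map_sum]
  refine Finset.sum_congr rfl fun i _ => ?_
  rw [← coeff_C_mul]
  congr 1
  simp only [map_pow, map_neg, map_one]
  ring

/-- For `1 ≤ m ≤ n`,
`P(n, m) = ∑_{k=0}^{n−m} ∑_{i=0}^{k} (−1)^i · P(k − i(i−1)/2, i) · P(n − k − m(i+1))`,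
where every term in which an argument of `P(·, ·)` or `P(·)` is negative is zero. -/
theorem partitionsInParts_eq_double_sum (n m : ℕ) (hm : 1 ≤ m) (hmn : m ≤ n) :
    (partitionsInParts n m : ℤ) =
      ∑ k ∈ Finset.range (n - m + 1), ∑ i ∈ Finset.range (k + 1),
        (-1 : ℤ) ^ i *
          (if i * (i - 1) / 2 ≤ k then (partitionsInParts (k - i * (i - 1) / 2) i : ℤ) else 0) *
          (if k + m * (i + 1) ≤ n then (partitionCount (n - k - m * (i + 1)) : ℤ) else 0) := by
  rw [partitionsInParts_eq_sum_coeff, Finset.sum_congr rfl fun i _ => by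
    rw [PowerSeries.coeff_mul, Finset.Nat.sum_antidiagonal_eq_sum_range_succ_mk, Finset.mul_sum],
    Finset.sum_comm]
  simp only [PowerSeries.coeff_X_pow_mul']
  symm
  refine (Finset.sum_congr rfl fun k hk => ?_).trans
    (Finset.sum_subset (Finset.range_subset_range.2 (by omega)) fun k hk hk' => ?_)
  · rw [Finset.mem_range] at hk
    refine (Finset.sum_congr rfl fun i hi => ?_).trans
      (Finset.sum_subset (Finset.range_subset_range.2 (by omega)) fun i hi hi' => ?_)
    · have hiff : k + m * (i + 1) ≤ n ↔ m * (i + 1) ≤ n - k := by omega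
      simp only [partsSeries, partitionSeries, PowerSeries.coeff_mk, hiff, mul_assoc]
    · rw [Finset.mem_range] at hi'
      simp [partsSeries, partitionsInParts_eq_zero (show k - i * (i - 1) / 2 < i by omega)]
  · rw [Finset.mem_range] at hk hk'
    refine Finset.sum_eq_zero fun i _ => ?_
    have : m ≤ m * (i + 1) := Nat.le_mul_of_pos_right m i.succ_pos
    rw [if_neg (show ¬ m * (i + 1) ≤ n - k by omega)]
    simp
end

section
/- For every natural number n ≥ 1, Ewell's recurrence holds: P(n) = ∑_{k≥0, 4 | (n − k(k+1)/2)} P((n − k(k+1)/2)/4) − 2·∑_{k=1}^{∞} (−1)^k P(n − 2k²), where the first sum is over all nonnegative integers k such that n − k(k+1)/2 is a nonnegative multiple of 4, the second sum is over all positive integers k with n − 2k² ≥ 0, and P of a negative argument is 0. -/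
open Finset

/-- A finite form of Gauss' identity `∑ (-1)^k q^(k²) = ∏ (1 - q^j) / (1 + q^j)`. -/
theorem prod_one_add_pow_mul_sum_sq {R : Type*} [CommRing R] (q : R) (n : ℕ) :
    (∏ j ∈ range n, (1 + q ^ (j + 1))) * (1 + 2 * ∑ k ∈ Icc 1 n, (-1) ^ k * q ^ (k ^ 2)) =
      ∏ j ∈ range n, (1 - q ^ (j + 1)) +
        2 * ∑ s ∈ range n, (-1) ^ (s + 1) * (∏ j ∈ Ico (s + 1) n, (1 - q ^ (j + 1))) *
          (∏ j ∈ range s, (1 + q ^ (j + 1))) * q ^ ((s + 1) * (n + 1)) := by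
  induction n with
  | zero => simp
  | succ n ih =>
    have telescope : ∀ m ≤ n,
        ∑ s ∈ range m, (-1) ^ (s + 1) * (∏ j ∈ Ico (s + 1) (n + 1), (1 - q ^ (j + 1))) *
          (∏ j ∈ range s, (1 + q ^ (j + 1))) * q ^ ((s + 1) * (n + 1 + 1)) =
        (1 + q ^ (n + 1)) * ∑ s ∈ range m, (-1) ^ (s + 1) *
          (∏ j ∈ Ico (s + 1) n, (1 - q ^ (j + 1))) *
          (∏ j ∈ range s, (1 + q ^ (j + 1))) * q ^ ((s + 1) * (n + 1)) +
        q ^ (n + 1) * ∏ j ∈ range n, (1 - q ^ (j + 1)) -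
        (-1) ^ m * q ^ ((m + 1) * (n + 1)) * (∏ j ∈ Ico m n, (1 - q ^ (j + 1))) *
          ∏ j ∈ range m, (1 + q ^ (j + 1)) := by
      intro m hm
      induction m with
      | zero => simp
      | succ m ihm =>
        rw [sum_range_succ, sum_range_succ, ihm (by omega), prod_range_succ _ m,
          prod_Ico_succ_top (by omega), prod_eq_prod_Ico_succ_bot (show m < n by omega)]
        ring
    rw [sum_Icc_succ_top (by omega), prod_range_succ, prod_range_succ, sum_range_succ,
      telescope n le_rfl]
    simp only [Ico_self, prod_empty]
    linear_combination (1 + q ^ (n + 1)) * ih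

/-- A finite form of Gauss' identity `∑ q^(k(k+1)/2) = ∏ (1 - q^(2j)) / (1 - q^(2j-1))`. -/
theorem prod_one_sub_odd_pow_mul_sum_triangle {R : Type*} [CommRing R] (q : R) (n : ℕ) :
    (∏ j ∈ range n, (1 - q ^ (2 * j + 1))) * ∑ k ∈ range (2 * n + 1), q ^ (k * (k + 1) / 2) =
      ∑ s ∈ range (n + 1), (∏ j ∈ Ico s n, (1 - (q ^ 2) ^ (j + 1))) *
        (∏ j ∈ range s, (1 - q ^ (2 * j + 1))) * q ^ (s * (2 * n + 1)) := by
  induction n with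
  | zero => simp
  | succ n ih =>
    have telescope : ∀ m ≤ n,
        ∑ s ∈ range (m + 1), (∏ j ∈ Ico s (n + 1), (1 - (q ^ 2) ^ (j + 1))) *
          (∏ j ∈ range s, (1 - q ^ (2 * j + 1))) * q ^ (s * (2 * (n + 1) + 1)) =
        (1 - q ^ (2 * n + 1)) * ∑ s ∈ range (m + 1),
          (∏ j ∈ Ico s n, (1 - (q ^ 2) ^ (j + 1))) *
          (∏ j ∈ range s, (1 - q ^ (2 * j + 1))) * q ^ (s * (2 * n + 1)) +
        (∏ j ∈ Ico m n, (1 - (q ^ 2) ^ (j + 1))) *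
          (∏ j ∈ range (m + 1), (1 - q ^ (2 * j + 1))) * q ^ ((m + 1) * (2 * n + 1)) := by
      intro m hm
      induction m with
      | zero =>
        simp only [zero_add, sum_range_one, prod_range_zero, prod_range_one]
        rw [prod_Ico_succ_top (by omega)]
        ring
      | succ m ihm =>
        rw [sum_range_succ, sum_range_succ _ (m + 1), ihm (by omega), prod_range_succ _ (m + 1),
          prod_Ico_succ_top (by omega), prod_eq_prod_Ico_succ_bot (show m < n by omega)]
        ring
    have h₁ : (2 * n + 1) * (2 * n + 1 + 1) / 2 = (n + 1) * (2 * n + 1) :=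
      Nat.div_eq_of_eq_mul_left two_pos (by ring)
    have h₂ : (2 * n + 1 + 1) * (2 * n + 1 + 1 + 1) / 2 = (n + 1) * (2 * n + 3) :=
      Nat.div_eq_of_eq_mul_left two_pos (by ring)
    rw [sum_range_succ _ (n + 1), telescope n le_rfl, ← ih,
      show 2 * (n + 1) + 1 = 2 * n + 1 + 1 + 1 by ring, sum_range_succ, sum_range_succ _ (2 * n + 1),
      h₁, h₂]
    simp only [Ico_self, prod_empty, prod_range_succ]
    ring

theorem prod_one_add_pow_mul_sum_sq_of_pow_eq_zero {R : Type*} [CommRing R] {q : R} {n : ℕ}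
    (hq : q ^ (n + 1) = 0) :
    (∏ j ∈ range n, (1 + q ^ (j + 1))) * (1 + 2 * ∑ k ∈ Icc 1 n, (-1) ^ k * q ^ (k ^ 2)) =
      ∏ j ∈ range n, (1 - q ^ (j + 1)) := by
  rw [prod_one_add_pow_mul_sum_sq, sum_eq_zero, mul_zero, add_zero]
  intro s _
  rw [mul_comm (s + 1), pow_mul, hq, zero_pow (by omega), mul_zero]

theorem prod_one_sub_odd_pow_mul_sum_triangle_of_pow_eq_zero {R : Type*} [CommRing R] {q : R}
    {n : ℕ} (hq : q ^ (n + 1) = 0) :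
    (∏ j ∈ range n, (1 - q ^ (2 * j + 1))) * ∑ k ∈ range (2 * n + 1), q ^ (k * (k + 1) / 2) =
      ∏ j ∈ range n, (1 - (q ^ 2) ^ (j + 1)) := by
  rw [prod_one_sub_odd_pow_mul_sum_triangle, sum_range_succ', sum_eq_zero]
  · simp
  intro s _
  rw [pow_eq_zero_of_le (show n + 1 ≤ (s + 1) * (2 * n + 1) by nlinarith) hq, mul_zero]

theorem prod_range_two_mul_one_sub_pow {R : Type*} [CommRing R] (q : R) (n : ℕ) :
    ∏ j ∈ range (2 * n), (1 - q ^ (j + 1)) =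
      (∏ j ∈ range n, (1 - q ^ (2 * j + 1))) * ∏ j ∈ range n, (1 - (q ^ 2) ^ (j + 1)) := by
  induction n with
  | zero => simp
  | succ n ih =>
    rw [Nat.mul_succ, prod_range_succ, prod_range_succ, ih, prod_range_succ, prod_range_succ]
    ring

open PowerSeries PowerSeries.WithPiTopology in
theorem mk_partitionCount_mul_pentagonalSeries :
    (PowerSeries.mk fun n ↦ (partitionCount n : ℤ)) * pentagonalSeries ℤ = 1 := by
  let : TopologicalSpace ℤ := ⊥
  have : DiscreteTopology ℤ := ⟨rfl⟩
  have h₁ := Nat.Partition.hasProd_powerSeriesMk_card_restricted ℤ (fun _ ↦ True)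
  have h₂ := h₁.mul (hasProd_one_sub_X_pow ℤ)
  have h₃ : ∀ i : ℕ, (if True then ∑' j : ℕ, (X : ℤ⟦X⟧) ^ ((i + 1) * j) else 1) *
      (1 - X ^ (i + 1)) = 1 := by
    intro i
    simp only [if_true, pow_mul]
    exact tsum_pow_mul_one_sub_of_constantCoeff_eq_zero (by simp)
  simp only [h₃] at h₂
  simpa [Nat.Partition.restricted, partitionCount] using (hasProd_one.unique h₂).symm

theorem exists_X_pow_dvd_partitionCount (n : ℕ) : ∃ M, n ≤ M ∧
    (Polynomial.X : Polynomial ℤ) ^ (n + 1) ∣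
      (∑ m ∈ range (n + 1), (partitionCount m : Polynomial ℤ) * Polynomial.X ^ m) *
        ∏ j ∈ range M, (1 - Polynomial.X ^ (j + 1)) - 1 := by
  have h : ∀ᶠ s : Finset ℕ in Filter.atTop, ∀ d ∈ range (n + 1),
      (∏ j ∈ s, (1 - PowerSeries.X ^ (j + 1) : PowerSeries ℤ)).coeff d =
        (PowerSeries.pentagonalSeries ℤ).coeff d := by
    rw [Filter.eventually_all_finset]
    exact fun d _ ↦ PowerSeries.coeff_prod_one_sub_X_pow_eventually_eq ℤ d
  obtain ⟨M, hM, hnM⟩ := ((Filter.tendsto_finset_range.eventually h).and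
    (Filter.eventually_ge_atTop n)).exists
  refine ⟨M, hnM, ?_⟩
  rw [Polynomial.X_pow_dvd_iff]
  intro d hd
  rw [Polynomial.coeff_sub, sub_eq_zero, ← Polynomial.coeff_coe, ← Polynomial.coeff_coe,
    Polynomial.coe_one, ← mk_partitionCount_mul_pentagonalSeries, Polynomial.coe_mul,
    PowerSeries.coeff_mul, PowerSeries.coeff_mul]
  refine sum_congr rfl fun x hx ↦ ?_
  have hx' := mem_antidiagonal.mp hx
  congr 1
  · simp [Polynomial.finsetSum_coeff, Polynomial.coeff_natCast_mul, Polynomial.coeff_X_pow]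
    omega
  · rw [← hM x.2 (by simp; omega)]
    congr 1
    rw [← Polynomial.coeToPowerSeries.ringHom_apply, map_prod]
    simp

theorem sum_partitionCount_mul_prod_of_pow_eq_zero {R : Type*} [CommRing R] {q : R} {n : ℕ}
    (hq : q ^ (n + 1) = 0) {M : ℕ} (hM : n ≤ M) :
    (∑ m ∈ range (n + 1), (partitionCount m : R) * q ^ m) *
      ∏ j ∈ range M, (1 - q ^ (j + 1)) = 1 := by
  have stable : ∀ L, n ≤ L →
      ∏ j ∈ range L, (1 - q ^ (j + 1)) = ∏ j ∈ range n, (1 - q ^ (j + 1)) := by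
    intro L hL
    refine (prod_subset (range_subset_range.mpr hL) fun j _ hj ↦ ?_).symm
    rw [pow_eq_zero_of_le (by simpa using hj) hq, sub_zero]
  obtain ⟨L, hL, hdvd⟩ := exists_X_pow_dvd_partitionCount n
  have h := map_dvd (Polynomial.aeval q) hdvd
  simp only [map_sub, map_mul, map_sum, map_prod, map_pow, map_one, Polynomial.aeval_X,
    map_natCast, hq, zero_dvd_iff, sub_eq_zero] at h
  rw [stable M hM, ← stable L hL, h]

/-- Ewell's recurrence as an identity of generating functions truncated at order `n`. -/
theorem sum_partitionCount_mul_sum_sq_of_pow_eq_zero {R : Type*} [CommRing R] {q : R} {n : ℕ}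
    (hq : q ^ (n + 1) = 0) :
    (∑ m ∈ range (n + 1), (partitionCount m : R) * q ^ m) *
        (1 + 2 * ∑ k ∈ Icc 1 n, (-1) ^ k * (q ^ 2) ^ (k ^ 2)) =
      (∑ m ∈ range (n + 1), (partitionCount m : R) * (q ^ 4) ^ m) *
        ∑ k ∈ range (2 * n + 1), q ^ (k * (k + 1) / 2) := by
  have hq₂ : (q ^ 2) ^ (n + 1) = 0 := by rw [pow_right_comm, hq, zero_pow two_ne_zero]
  have hq₄ : (q ^ 4) ^ (n + 1) = 0 := by rw [pow_right_comm, hq, zero_pow four_ne_zero]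
  have hsq := prod_one_add_pow_mul_sum_sq_of_pow_eq_zero hq₂
  have htri := prod_one_sub_odd_pow_mul_sum_triangle_of_pow_eq_zero hq
  have hP := sum_partitionCount_mul_prod_of_pow_eq_zero hq (show n ≤ 2 * n by omega)
  have hP₄ := sum_partitionCount_mul_prod_of_pow_eq_zero hq₄ le_rfl
  have hprod : ∏ j ∈ range n, (1 - (q ^ 4) ^ (j + 1)) =
      (∏ j ∈ range n, (1 - (q ^ 2) ^ (j + 1))) * ∏ j ∈ range n, (1 + (q ^ 2) ^ (j + 1)) := by
    rw [← prod_mul_distrib]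
    exact prod_congr rfl fun j _ ↦ by ring
  rw [prod_range_two_mul_one_sub_pow] at hP
  rw [hprod] at hP₄
  generalize ∑ m ∈ range (n + 1), (partitionCount m : R) * q ^ m = P at *
  generalize ∑ m ∈ range (n + 1), (partitionCount m : R) * (q ^ 4) ^ m = P₄ at *
  generalize 1 + 2 * ∑ k ∈ Icc 1 n, (-1) ^ k * (q ^ 2) ^ (k ^ 2) = Φ at *
  generalize ∑ k ∈ range (2 * n + 1), q ^ (k * (k + 1) / 2) = Ψ at *
  generalize ∏ j ∈ range n, (1 - (q ^ 2) ^ (j + 1)) = a at *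
  generalize ∏ j ∈ range n, (1 + (q ^ 2) ^ (j + 1)) = d at *
  generalize ∏ j ∈ range n, (1 - q ^ (2 * j + 1)) = o at *
  linear_combination (-P * Φ) * hP₄ + P * P₄ * a * hsq - P * P₄ * a * htri + P₄ * Ψ * hP

open Polynomial in
theorem coeff_sum_partitionCount_mul_X_pow (n d : ℕ) (hd : d ≤ n) :
    (∑ m ∈ range (n + 1), (partitionCount m : ℤ[X]) * X ^ m).coeff d =
      (partitionCount d : ℤ) := by
  simp [finsetSum_coeff, coeff_natCast_mul, coeff_X_pow]
  omega

open Polynomial in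
theorem coeff_sum_partitionCount_mul_X_pow_four (n d : ℕ) (hd : d ≤ n) :
    (∑ m ∈ range (n + 1), (partitionCount m : ℤ[X]) * (X ^ 4) ^ m).coeff d =
      if 4 ∣ d then (partitionCount (d / 4) : ℤ) else 0 := by
  simp only [finsetSum_coeff, coeff_natCast_mul, ← pow_mul, coeff_X_pow, mul_ite, mul_one,
    mul_zero]
  split_ifs with h
  · obtain ⟨c, rfl⟩ := h
    rw [sum_eq_single c]
    · simp
    · intro b _ hb
      rw [if_neg (by omega)]
    · intro hc
      simp at hc
      omega
  · exact sum_eq_zero fun m _ ↦ if_neg (by omega)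

/-- Ewell's recurrence: for `n ≥ 1`,
`P(n) = ∑_{k≥0, 4 ∣ (n − k(k+1)/2)} P((n − k(k+1)/2)/4) − 2·∑_{k=1}^{∞} (−1)^k P(n − 2k²)`,
where the first sum is over nonnegative `k` with `n − k(k+1)/2` a nonnegative
multiple of `4`, the second over positive `k` with `n − 2k² ≥ 0`.  All nonzero
terms have `k ≤ n`, so the sums are taken over `0 ≤ k ≤ n` and `1 ≤ k ≤ n`. -/
theorem ewell_recurrence (n : ℕ) (hn : 1 ≤ n) :
    (partitionCount n : ℤ) =
      (∑ k ∈ Finset.range (n + 1),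
        if k * (k + 1) / 2 ≤ n ∧ 4 ∣ (n - k * (k + 1) / 2) then
          (partitionCount ((n - k * (k + 1) / 2) / 4) : ℤ) else 0) -
      2 * ∑ k ∈ Finset.Icc 1 n,
        (-1 : ℤ) ^ k *
          (if 2 * k ^ 2 ≤ n then (partitionCount (n - 2 * k ^ 2) : ℤ) else 0) := by
  let I : Ideal (Polynomial ℤ) := Ideal.span {Polynomial.X ^ (n + 1)}
  have hq : (Ideal.Quotient.mk I Polynomial.X) ^ (n + 1) = 0 := by
    rw [← map_pow, Ideal.Quotient.eq_zero_iff_mem]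
    exact Ideal.mem_span_singleton_self _
  have key := sum_partitionCount_mul_sum_sq_of_pow_eq_zero hq
  have hdvd : (Polynomial.X : Polynomial ℤ) ^ (n + 1) ∣
      (∑ m ∈ range (n + 1), (partitionCount m : Polynomial ℤ) * Polynomial.X ^ m) *
        (1 + 2 * ∑ k ∈ Icc 1 n, (-1) ^ k * (Polynomial.X ^ 2) ^ (k ^ 2)) -
      (∑ m ∈ range (n + 1), (partitionCount m : Polynomial ℤ) * (Polynomial.X ^ 4) ^ m) *
        ∑ k ∈ range (2 * n + 1), Polynomial.X ^ (k * (k + 1) / 2) := by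
    rw [← Ideal.mem_span_singleton, ← Ideal.Quotient.eq]
    simpa [I, map_ofNat] using key
  have hcoeff := Polynomial.X_pow_dvd_iff.mp hdvd n (Nat.lt_succ_self n)
  have hsq : ∀ k : ℕ,
      ((∑ m ∈ range (n + 1), (partitionCount m : Polynomial ℤ) * Polynomial.X ^ m) *
        ((-1) ^ k * (Polynomial.X ^ 2) ^ (k ^ 2))).coeff n =
      (-1) ^ k * (if 2 * k ^ 2 ≤ n then (partitionCount (n - 2 * k ^ 2) : ℤ) else 0) := by
    intro k
    rw [show ((-1 : Polynomial ℤ)) ^ k = Polynomial.C ((-1) ^ k) by simp, mul_left_comm,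
      Polynomial.coeff_C_mul, ← pow_mul, Polynomial.coeff_mul_X_pow',
      coeff_sum_partitionCount_mul_X_pow _ _ (Nat.sub_le _ _)]
  have htri : ∀ k : ℕ,
      ((∑ m ∈ range (n + 1), (partitionCount m : Polynomial ℤ) * (Polynomial.X ^ 4) ^ m) *
        Polynomial.X ^ (k * (k + 1) / 2)).coeff n =
      if k * (k + 1) / 2 ≤ n ∧ 4 ∣ (n - k * (k + 1) / 2) then
          (partitionCount ((n - k * (k + 1) / 2) / 4) : ℤ) else 0 := by
    intro k
    rw [Polynomial.coeff_mul_X_pow', coeff_sum_partitionCount_mul_X_pow_four _ _ (Nat.sub_le _ _),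
      ite_and]
  have hrange : ∑ k ∈ range (2 * n + 1),
      (if k * (k + 1) / 2 ≤ n ∧ 4 ∣ (n - k * (k + 1) / 2) then
          (partitionCount ((n - k * (k + 1) / 2) / 4) : ℤ) else 0) =
      ∑ k ∈ range (n + 1), if k * (k + 1) / 2 ≤ n ∧ 4 ∣ (n - k * (k + 1) / 2) then
          (partitionCount ((n - k * (k + 1) / 2) / 4) : ℤ) else 0 := by
    refine (sum_subset (range_subset_range.mpr (by omega)) fun k _ hk ↦ if_neg ?_).symm
    rintro ⟨hle, -⟩
    rw [mem_range, not_lt] at hk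
    have : n + 1 ≤ k * (k + 1) / 2 := by
      rw [Nat.le_div_iff_mul_le two_pos]
      nlinarith
    omega
  rw [mul_add, mul_one, mul_left_comm, mul_sum (Icc 1 n), mul_sum (range (2 * n + 1)),
    Polynomial.coeff_sub,
    Polynomial.coeff_add, coeff_sum_partitionCount_mul_X_pow _ _ le_rfl,
    Polynomial.coeff_ofNat_mul, Polynomial.finsetSum_coeff, Polynomial.finsetSum_coeff] at hcoeff
  simp only [hsq, htri, hrange] at hcoeff
  linarith
end
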